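/- arXiv:1901.11017 — 2 statements merged into one kernel-verified Lean document; each statement's English description precedes it below -/
import Mathlib

section
/- Let 1 < μ ≤ 2 and ω > 0, and let G be the Green's function defined as above. Then 0 ≤ G(t,τ) ≤ E_{μ,μ}(ω) for all (t,τ) ∈ [0,1] × [0,1]. -/
open Real

/-- Two-parameter Mittag-Leffler function `E_{μ,ν}(t) = ∑ t^k / Γ(μk + ν)`. -/
noncomputable def mittagLeffler (μ ν t : ℝ) : ℝ :=
  ∑' k : ℕ, t ^ k / Real.Gamma (μ * k + ν)

/-- Green's function of the BVP `ᶜD^μ x + y = ω x`, `x'(0) = 0`, `x(1) = 0`. -/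
noncomputable def greenG (μ ω t τ : ℝ) : ℝ :=
  mittagLeffler μ 1 (ω * t ^ μ) / mittagLeffler μ 1 ω *
      ((1 - τ) ^ (μ - 1) * mittagLeffler μ μ (ω * (1 - τ) ^ μ)) -
    (if τ ≤ t then (t - τ) ^ (μ - 1) * mittagLeffler μ μ (ω * (t - τ) ^ μ) else 0)


open Filter Topology MeasureTheory Set

/-- The power-weighted Mittag-Leffler function `∑ ω^k t^(μk+ν-1) / Γ(μk+ν)`, which equals
`t^(ν-1) E_{μ,ν}(ω t^μ)`. -/
noncomputable def mittagLefflerKernel (μ ω ν t : ℝ) : ℝ :=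
  ∑' k : ℕ, ω ^ k * t ^ (μ * k + ν - 1) / Real.Gamma (μ * k + ν)

theorem div_Gamma_add_one (s : ℝ) : s / Real.Gamma (s + 1) = 1 / Real.Gamma s := by
  rcases eq_or_ne s 0 with rfl | hs
  · simp
  · rw [Real.Gamma_add_one hs, ← div_div, div_self hs]

theorem summable_mittagLeffler {μ : ℝ} (hμ : 1 ≤ μ) (ν z : ℝ) :
    Summable fun k : ℕ => z ^ k / Real.Gamma (μ * k + ν) := by
  obtain ⟨N, hN⟩ := exists_nat_ge (-ν)
  rw [← summable_nat_add_iff (N + 2)]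
  refine Summable.of_norm_bounded
    (g := fun j : ℕ => |z| ^ (N + 2) * (|z| ^ j / (j.factorial : ℝ)))
    ((Real.summable_pow_div_factorial |z|).mul_left _) fun j => ?_
  have hle : ((j + 1 : ℕ) : ℝ) + 1 ≤ μ * ((j + (N + 2) : ℕ) : ℝ) + ν := by
    push_cast
    nlinarith [mul_le_mul_of_nonneg_right hμ
      (by positivity : (0 : ℝ) ≤ (j : ℝ) + ((N : ℝ) + 2))]
  have hfac : (j.factorial : ℝ) ≤ Real.Gamma (μ * ((j + (N + 2) : ℕ) : ℝ) + ν) := by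
    have h2 : (2 : ℝ) ≤ ((j + 1 : ℕ) : ℝ) + 1 := by
      push_cast
      linarith [(Nat.cast_nonneg j : (0 : ℝ) ≤ j)]
    calc (j.factorial : ℝ) ≤ ((j + 1).factorial : ℝ) := by
          exact_mod_cast Nat.factorial_le (Nat.le_succ j)
      _ = Real.Gamma (((j + 1 : ℕ) : ℝ) + 1) := (Real.Gamma_nat_eq_factorial (j + 1)).symm
      _ ≤ _ := Real.Gamma_strictMonoOn_Ici.monotoneOn h2 (h2.trans hle) hle
  have hpos : (0 : ℝ) < j.factorial := by positivity
  rw [norm_div, norm_pow, Real.norm_eq_abs, Real.norm_of_nonneg (hpos.le.trans hfac), pow_add,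
    mul_comm (|z| ^ j), mul_div_assoc]
  gcongr

theorem Gamma_pos_of_index {μ ν : ℝ} (hμ : 0 ≤ μ) (hν : 0 < ν) (k : ℕ) :
    0 < Real.Gamma (μ * k + ν) :=
  Real.Gamma_pos_of_pos (by positivity)

theorem mittagLeffler_nonneg {μ ν z : ℝ} (hμ : 0 ≤ μ) (hν : 0 < ν) (hz : 0 ≤ z) :
    0 ≤ mittagLeffler μ ν z :=
  tsum_nonneg fun k => div_nonneg (pow_nonneg hz k) (Gamma_pos_of_index hμ hν k).le

theorem mittagLeffler_mono {μ ν y z : ℝ} (hμ : 1 ≤ μ) (hν : 0 < ν) (hy : 0 ≤ y) (hyz : y ≤ z) :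
    mittagLeffler μ ν y ≤ mittagLeffler μ ν z := by
  refine Summable.tsum_le_tsum (fun k => ?_) (summable_mittagLeffler hμ ν y)
    (summable_mittagLeffler hμ ν z)
  have := Gamma_pos_of_index (by linarith : 0 ≤ μ) hν k
  gcongr

theorem mittagLeffler_one_pos {μ z : ℝ} (hμ : 1 ≤ μ) (hz : 0 ≤ z) : 0 < mittagLeffler μ 1 z := by
  refine (summable_mittagLeffler hμ 1 z).tsum_pos (fun k => ?_) 0 (by simp)
  exact div_nonneg (pow_nonneg hz k) (Gamma_pos_of_index (by linarith) one_pos k).le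

theorem mittagLefflerKernel_term {μ ω ν t : ℝ} (hμ : 0 ≤ μ) (h : 0 < t ∨ 0 ≤ t ∧ 1 ≤ ν) (k : ℕ) :
    ω ^ k * t ^ (μ * k + ν - 1) / Real.Gamma (μ * k + ν) =
      t ^ (ν - 1) * ((ω * t ^ μ) ^ k / Real.Gamma (μ * k + ν)) := by
  have ht : t ^ (μ * k + ν - 1) = t ^ (ν - 1) * (t ^ μ) ^ k := by
    rw [show μ * k + ν - 1 = (ν - 1) + μ * k by ring]
    rcases h with h | ⟨h, hν⟩
    · rw [Real.rpow_add h, Real.rpow_mul h.le, Real.rpow_natCast]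
    · rw [Real.rpow_add_of_nonneg h (by linarith) (by positivity), Real.rpow_mul h,
        Real.rpow_natCast]
  rw [ht, mul_pow]
  ring

theorem summable_mittagLefflerKernel {μ ω ν t : ℝ} (hμ : 1 ≤ μ) (h : 0 < t ∨ 0 ≤ t ∧ 1 ≤ ν) :
    Summable fun k : ℕ => ω ^ k * t ^ (μ * k + ν - 1) / Real.Gamma (μ * k + ν) := by
  simp_rw [mittagLefflerKernel_term (ω := ω) (by linarith : 0 ≤ μ) h]
  exact (summable_mittagLeffler hμ ν _).mul_left _

theorem mittagLefflerKernel_eq {μ ω ν t : ℝ} (hμ : 0 ≤ μ) (h : 0 < t ∨ 0 ≤ t ∧ 1 ≤ ν) :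
    mittagLefflerKernel μ ω ν t = t ^ (ν - 1) * mittagLeffler μ ν (ω * t ^ μ) := by
  simp_rw [mittagLefflerKernel, mittagLefflerKernel_term (ω := ω) hμ h, tsum_mul_left,
    mittagLeffler]

theorem mittagLefflerKernel_recurrence {μ ω ν t : ℝ} (hμ : 1 ≤ μ) (ht : 0 < t) :
    mittagLefflerKernel μ ω ν t =
      t ^ (ν - 1) / Real.Gamma ν + ω * mittagLefflerKernel μ ω (ν + μ) t := by
  rw [mittagLefflerKernel, (summable_mittagLefflerKernel hμ (Or.inl ht)).tsum_eq_zero_add,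
    mittagLefflerKernel, ← tsum_mul_left]
  congr 1
  · simp
  · refine tsum_congr fun k => ?_
    rw [show μ * ((k + 1 : ℕ) : ℝ) + ν = μ * k + (ν + μ) by push_cast; ring, pow_succ]
    ring

theorem hasDerivAt_mittagLefflerKernel {μ ω : ℝ} (hμ : 1 ≤ μ) (ν : ℝ) {t : ℝ} (ht : 0 < t) :
    HasDerivAt (mittagLefflerKernel μ ω ν) (mittagLefflerKernel μ ω (ν - 1) t) t := by
  have ha : 0 < t / 2 := by linarith
  have hb : 0 < 2 * t := by linarith
  have htm : t ∈ Ioo (t / 2) (2 * t) := ⟨by linarith, by linarith⟩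
  refine hasDerivAt_tsum_of_isPreconnected
    (g := fun (k : ℕ) z => ω ^ k * z ^ (μ * k + ν - 1) / Real.Gamma (μ * k + ν))
    (g' := fun (k : ℕ) z => ω ^ k * z ^ (μ * k + (ν - 1) - 1) / Real.Gamma (μ * k + (ν - 1)))
    (u := fun k : ℕ => |ω ^ k * (t / 2) ^ (μ * k + (ν - 1) - 1) / Real.Gamma (μ * k + (ν - 1))| +
      |ω ^ k * (2 * t) ^ (μ * k + (ν - 1) - 1) / Real.Gamma (μ * k + (ν - 1))|)
    ((summable_mittagLefflerKernel hμ (Or.inl ha)).abs.add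
      (summable_mittagLefflerKernel hμ (Or.inl hb)).abs)
    isOpen_Ioo isPreconnected_Ioo (fun k y hy => ?_) (fun k y hy => ?_) htm
    (summable_mittagLefflerKernel hμ (Or.inl ht)) htm
  · have hy0 : 0 < y := ha.trans hy.1
    convert! ((Real.hasDerivAt_rpow_const (p := μ * k + ν - 1) (Or.inl hy0.ne')).const_mul
      (ω ^ k)).div_const (Real.Gamma (μ * k + ν)) using 1
    have h := div_Gamma_add_one (μ * k + (ν - 1))
    rw [show μ * k + (ν - 1) + 1 = μ * k + ν by ring] at h
    rw [div_eq_mul_one_div, ← h, show μ * k + (ν - 1) - 1 = μ * k + ν - 1 - 1 by ring]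
    ring
  · have hy0 : 0 < y := ha.trans hy.1
    set p := μ * k + (ν - 1) - 1
    have hp : y ^ p ≤ (t / 2) ^ p + (2 * t) ^ p := by
      have h1 := Real.rpow_nonneg ha.le p
      have h2 := Real.rpow_nonneg hb.le p
      rcases le_total 0 p with h0 | h0
      · linarith [Real.rpow_le_rpow hy0.le hy.2.le h0]
      · linarith [Real.rpow_le_rpow_of_nonpos ha hy.1.le h0]
    rw [Real.norm_eq_abs]
    simp only [abs_div, abs_mul, abs_of_nonneg (Real.rpow_nonneg hy0.le p),
      abs_of_nonneg (Real.rpow_nonneg ha.le p), abs_of_nonneg (Real.rpow_nonneg hb.le p)]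
    rw [← add_div, ← mul_add]
    gcongr

theorem continuousOn_mittagLefflerKernel {μ ω ν : ℝ} (hμ : 1 ≤ μ) (hω : 0 ≤ ω) (hν : 1 ≤ ν)
    (T : ℝ) : ContinuousOn (mittagLefflerKernel μ ω ν) (Icc 0 T) := by
  rcases lt_or_ge T 0 with hT | hT
  · simp [Icc_eq_empty hT.not_ge]
  have hp (k : ℕ) : 0 ≤ μ * k + ν - 1 := by
    have : 0 ≤ μ * k := by positivity
    linarith
  refine continuousOn_tsum (fun k => ?_)
    (summable_mittagLefflerKernel (ω := ω) hμ (Or.inr ⟨hT, hν⟩)) fun k x hx => ?_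
  · exact ((Real.continuous_rpow_const (hp k)).const_mul _).div_const _ |>.continuousOn
  · have hG := Gamma_pos_of_index (by linarith : 0 ≤ μ) (by linarith : 0 < ν) k
    have hx0 := hx.1
    rw [Real.norm_of_nonneg (by positivity)]
    gcongr
    · exact hp k
    · exact hx.2

theorem integral_sub_rpow_mul_rpow {a b t : ℝ} (ha : 0 < a) (hb : 0 < b) (ht : 0 < t) :
    ∫ u in 0..t, (t - u) ^ (a - 1) * u ^ (b - 1) =
      Real.Gamma a * Real.Gamma b / Real.Gamma (b + a) * t ^ (b + a - 1) := by
  have h := Complex.betaIntegral_scaled (b : ℂ) (a : ℂ) ht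
  rw [Complex.betaIntegral_eq_Gamma_mul_div _ _ (by simpa) (by simpa)] at h
  rw [← Complex.ofReal_inj, ← intervalIntegral.integral_ofReal]
  have h2 : ∀ u ∈ uIcc 0 t, (((t - u) ^ (a - 1) * u ^ (b - 1) : ℝ) : ℂ) =
      (u : ℂ) ^ ((b : ℂ) - 1) * ((t : ℂ) - u) ^ ((a : ℂ) - 1) := fun u hu => by
    rw [uIcc_of_le ht.le] at hu
    rw [Complex.ofReal_mul, Complex.ofReal_cpow (by linarith [hu.2]), Complex.ofReal_cpow hu.1]
    push_cast
    ring
  rw [intervalIntegral.integral_congr h2, h, Complex.Gamma_ofReal, Complex.Gamma_ofReal,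
    ← Complex.ofReal_add, Complex.Gamma_ofReal]
  push_cast [Complex.ofReal_cpow ht.le]
  ring

theorem intervalIntegrable_sub_rpow {a : ℝ} (ha : 0 < a) (t x y : ℝ) :
    IntervalIntegrable (fun u => (t - u) ^ (a - 1)) volume x y := by
  have h := (intervalIntegral.intervalIntegrable_rpow' (a := t - x) (b := t - y)
    (by linarith : -1 < a - 1)).comp_sub_left t
  simpa using h

theorem integral_sub_rpow_mul_mittagLefflerKernel {μ ω ν a t : ℝ} (hμ : 1 ≤ μ) (hω : 0 ≤ ω)
    (hν : 1 ≤ ν) (ha : 0 < a) (ht : 0 < t) :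
    ∫ u in 0..t, (t - u) ^ (a - 1) * mittagLefflerKernel μ ω ν u =
      Real.Gamma a * mittagLefflerKernel μ ω (ν + a) t := by
  have hGam (k : ℕ) := Gamma_pos_of_index (by linarith : 0 ≤ μ) (by linarith : 0 < ν) k
  have hp (k : ℕ) : 0 ≤ μ * k + ν - 1 := by
    have : 0 ≤ μ * k := by positivity
    linarith
  set f : ℕ → ℝ → ℝ := fun k u =>
    (t - u) ^ (a - 1) * (ω ^ k * u ^ (μ * k + ν - 1) / Real.Gamma (μ * k + ν)) with hf
  have hint (k : ℕ) : IntervalIntegrable (f k) volume 0 t :=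
    (intervalIntegrable_sub_rpow ha t 0 t).mul_continuousOn
      (((Real.continuous_rpow_const (hp k)).const_mul _).div_const _).continuousOn
  have hval (k : ℕ) : ∫ u in 0..t, f k u = Real.Gamma a *
      (ω ^ k * t ^ (μ * k + (ν + a) - 1) / Real.Gamma (μ * k + (ν + a))) := by
    have h := integral_sub_rpow_mul_rpow ha (by linarith [hp k] : 0 < μ * k + ν) ht
    have h3 : ∀ u, f k u = ω ^ k / Real.Gamma (μ * k + ν) *
        ((t - u) ^ (a - 1) * u ^ (μ * k + ν - 1)) := fun u => by simp only [hf]; ring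
    simp_rw [h3]
    rw [intervalIntegral.integral_const_mul, h, add_assoc]
    have := (hGam k).ne'
    field_simp
  have hnn (k : ℕ) : ∀ u ∈ Ioc 0 t, 0 ≤ f k u := fun u hu => by
    have h1 := Real.rpow_nonneg (by linarith [hu.2] : 0 ≤ t - u) (a - 1)
    have h2 := Real.rpow_nonneg hu.1.le (μ * k + ν - 1)
    have h3 := (hGam k).le
    positivity
  have hsum := hasSum_integral_of_summable_integral_norm (μ := volume.restrict (Ioc 0 t))
    (F := f) (fun k => (intervalIntegrable_iff_integrableOn_Ioc_of_le ht.le).1 (hint k)) (by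
      have h4 : ∀ k, ∫ u in Ioc 0 t, ‖f k u‖ = ∫ u in 0..t, f k u := fun k => by
        rw [intervalIntegral.integral_of_le ht.le]
        exact setIntegral_congr_fun measurableSet_Ioc fun u hu =>
          Real.norm_of_nonneg (hnn k u hu)
      simp_rw [h4, hval]
      exact (summable_mittagLefflerKernel hμ (Or.inl ht)).mul_left _)
  simp_rw [← intervalIntegral.integral_of_le ht.le, hval] at hsum
  rw [mittagLefflerKernel, ← tsum_mul_left, hsum.tsum_eq]
  refine intervalIntegral.integral_congr fun u _ => ?_
  simp only [hf, tsum_mul_left, mittagLefflerKernel]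

theorem two_mul_rpow_le_add_rpow {p w δ : ℝ} (hp : p ≤ 0) (hδ : 0 ≤ δ) (hw : δ < w) :
    2 * w ^ p ≤ (w + δ) ^ p + (w - δ) ^ p := by
  have h1 : 0 < w + δ := by linarith
  have h2 : 0 < w - δ := by linarith
  have hw0 : 0 < w := by linarith
  have h3 : w ^ p * w ^ p ≤ (w + δ) ^ p * (w - δ) ^ p := by
    rw [← Real.mul_rpow hw0.le hw0.le, ← Real.mul_rpow h1.le h2.le]
    exact Real.rpow_le_rpow_of_nonpos (by positivity) (by nlinarith) hp
  have := Real.rpow_nonneg h1.le p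
  have := Real.rpow_nonneg h2.le p
  have := Real.rpow_nonneg hw0.le p
  nlinarith [sq_nonneg ((w + δ) ^ p - (w - δ) ^ p)]

/-- Near a zero of a nonnegative function, the second difference of its fractional integral is
almost nonnegative. -/
theorem neg_le_secondDifference_integral_rpow_mul {a x δ M : ℝ} {P : ℝ → ℝ} (ha0 : 0 < a)
    (ha1 : a ≤ 1) (hδ : 0 < δ) (hδx : δ ≤ x) (hc : ContinuousOn P (Icc 0 (x + δ)))
    (hP : ∀ u ∈ Icc 0 (x + δ), 0 ≤ P u) (hM : ∀ u ∈ Icc (x - δ) x, P u ≤ M) :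
    -(2 * M * (δ ^ a / a)) ≤
      (∫ u in 0..(x + δ), (x + δ - u) ^ (a - 1) * P u) +
        (∫ u in 0..(x - δ), (x - δ - u) ^ (a - 1) * P u) -
        2 * ∫ u in 0..x, (x - u) ^ (a - 1) * P u := by
  have hint (c p q : ℝ) (hp : 0 ≤ p) (hpq : p ≤ q) (hq : q ≤ x + δ) :
      IntervalIntegrable (fun u => (c - u) ^ (a - 1) * P u) volume p q := by
    refine (intervalIntegrable_sub_rpow ha0 c p q).mul_continuousOn (hc.mono ?_)
    rw [uIcc_of_le hpq]
    exact Icc_subset_Icc hp hq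
  have hδx' : 0 ≤ x - δ := by linarith
  rw [← intervalIntegral.integral_add_adjacent_intervals
      (hint (x + δ) 0 (x - δ) le_rfl hδx' (by linarith))
      (hint (x + δ) (x - δ) (x + δ) hδx' (by linarith) le_rfl),
    ← intervalIntegral.integral_add_adjacent_intervals
      (hint x 0 (x - δ) le_rfl hδx' (by linarith))
      (hint x (x - δ) x hδx' (by linarith) (by linarith))]
  have h1 : 0 ≤ ∫ u in (x - δ)..(x + δ), (x + δ - u) ^ (a - 1) * P u :=
    intervalIntegral.integral_nonneg (by linarith) fun u hu =>
      mul_nonneg (Real.rpow_nonneg (by linarith [hu.2]) _) (hP u ⟨by linarith [hu.1], hu.2⟩)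
  have h2 : ∫ u in (x - δ)..x, (x - u) ^ (a - 1) * P u ≤ M * (δ ^ a / a) := by
    have hval : ∫ u in (x - δ)..x, (x - u) ^ (a - 1) = δ ^ a / a := by
      rw [intervalIntegral.integral_comp_sub_left (fun v => v ^ (a - 1)), sub_self, sub_sub_cancel,
        integral_rpow (Or.inl (by linarith)), sub_add_cancel, Real.zero_rpow ha0.ne', sub_zero]
    rw [← hval, mul_comm, ← intervalIntegral.integral_mul_const]
    refine intervalIntegral.integral_mono_on (by linarith)
      (hint x (x - δ) x hδx' (by linarith) (by linarith))
      ((intervalIntegrable_sub_rpow ha0 x _ _).mul_const _) fun u hu => ?_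
    exact mul_le_mul_of_nonneg_left (hM u hu) (Real.rpow_nonneg (by linarith [hu.2]) _)
  have h3 : 2 * ∫ u in 0..(x - δ), (x - u) ^ (a - 1) * P u ≤
      (∫ u in 0..(x - δ), (x + δ - u) ^ (a - 1) * P u) +
        ∫ u in 0..(x - δ), (x - δ - u) ^ (a - 1) * P u := by
    rw [← intervalIntegral.integral_const_mul, ← intervalIntegral.integral_add
      (hint (x + δ) 0 (x - δ) le_rfl hδx' (by linarith))
      (hint (x - δ) 0 (x - δ) le_rfl hδx' (by linarith))]
    refine intervalIntegral.integral_mono_on_of_le_Ioo hδx'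
      ((hint x 0 (x - δ) le_rfl hδx' (by linarith)).const_mul 2)
      ((hint (x + δ) 0 (x - δ) le_rfl hδx' (by linarith)).add
        (hint (x - δ) 0 (x - δ) le_rfl hδx' (by linarith))) fun u hu => ?_
    have hk := two_mul_rpow_le_add_rpow (p := a - 1) (w := x - u) (δ := δ) (by linarith) hδ.le
      (by linarith [hu.2])
    rw [show x - u + δ = x + δ - u by ring, show x - u - δ = x - δ - u by ring] at hk
    have := mul_le_mul_of_nonneg_right hk (hP u ⟨hu.1.le, by linarith [hu.2]⟩)
    linarith
  linarith

/-- Quadratic upper bound at a critical point. -/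
theorem eventually_sub_le_mul_sq {f f' : ℝ → ℝ} {x d c : ℝ}
    (hf : ∀ᶠ y in 𝓝 x, HasDerivAt f (f' y) y) (hf' : HasDerivAt f' d x) (h0 : f' x = 0)
    (hc : d < 2 * c) : ∀ᶠ y in 𝓝 x, f y - f x ≤ c * (y - x) ^ 2 := by
  have hg : ∀ᶠ y in 𝓝 x, HasDerivAt (fun y => c * (y - x) ^ 2 - f y)
      (2 * c * (y - x) - f' y) y := by
    filter_upwards [hf] with y hy
    convert! ((((hasDerivAt_id y).sub_const x).pow 2).const_mul c).sub hy using 1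
    simp
    ring
  have hg' : HasDerivAt (fun y => 2 * c * (y - x) - f' y) (2 * c - d) x := by
    convert! ((((hasDerivAt_id x).sub_const x)).const_mul (2 * c)).sub hf' using 1
    simp
  have hd : deriv (fun y => c * (y - x) ^ 2 - f y) =ᶠ[𝓝 x] fun y => 2 * c * (y - x) - f' y := by
    filter_upwards [hg] with y hy using hy.deriv
  have hmin := isLocalMin_of_deriv_deriv_pos
    (by rw [hd.deriv_eq, hg'.deriv]; linarith) (by rw [hd.eq_of_nhds, h0]; simp)
    hg.self_of_nhds.continuousAt
  filter_upwards [hmin] with y hy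
  simp only [sub_self] at hy
  linarith

theorem eventually_secondDifference_le {f f' : ℝ → ℝ} {x d c : ℝ}
    (hf : ∀ᶠ y in 𝓝 x, HasDerivAt f (f' y) y) (hf' : HasDerivAt f' d x) (hc : d < c) :
    ∀ᶠ δ in 𝓝 (0 : ℝ), f (x + δ) + f (x - δ) - 2 * f x ≤ c * δ ^ 2 := by
  have hp : Tendsto (fun δ : ℝ => x + δ) (𝓝 0) (𝓝 x) := by
    simpa using (continuous_const_add x).tendsto 0
  have hm : Tendsto (fun δ : ℝ => x - δ) (𝓝 0) (𝓝 x) := by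
    simpa using (continuous_sub_left x).tendsto 0
  have h1 : ∀ᶠ δ in 𝓝 (0 : ℝ), HasDerivAt (fun δ => f (x + δ) + f (x - δ))
      (f' (x + δ) - f' (x - δ)) δ := by
    filter_upwards [hp.eventually hf, hm.eventually hf] with δ h h'
    convert! (h.comp_const_add x δ).add (h'.comp_const_sub x δ) using 1
  have h2 : HasDerivAt (fun δ => f' (x + δ) - f' (x - δ)) (2 * d) 0 := by
    have ha := HasDerivAt.comp_const_add x 0 (f := f') (f' := d) (by simpa using hf')
    have hb := HasDerivAt.comp_const_sub x 0 (f := f') (f' := d) (by simpa using hf')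
    convert! ha.sub hb using 1
    ring
  filter_upwards [eventually_sub_le_mul_sq h1 h2 (by simp) (by linarith : 2 * d < 2 * c)]
    with δ hδ
  simp only [add_zero, sub_zero] at hδ
  linarith

theorem hasDerivAt_mittagLefflerKernel_combination {μ ω : ℝ} (hμ : 1 ≤ μ) (A B ν κ : ℝ) {τ t : ℝ}
    (hτ : 0 ≤ τ) (ht : τ < t) :
    HasDerivAt
      (fun t => A * mittagLefflerKernel μ ω ν t - B * mittagLefflerKernel μ ω κ (t - τ))
      (A * mittagLefflerKernel μ ω (ν - 1) t - B * mittagLefflerKernel μ ω (κ - 1) (t - τ)) t :=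
  ((hasDerivAt_mittagLefflerKernel hμ ν (hτ.trans_lt ht)).const_mul A).sub
    (((hasDerivAt_mittagLefflerKernel hμ κ (sub_pos.2 ht)).comp_sub_const t τ).const_mul B)

theorem mittagLefflerKernel_zero_right {μ ω ν : ℝ} (hμ : 0 ≤ μ) (hν : 1 < ν) :
    mittagLefflerKernel μ ω ν 0 = 0 := by
  rw [mittagLefflerKernel_eq hμ (Or.inr ⟨le_rfl, hν.le⟩), Real.zero_rpow (by linarith), zero_mul]

theorem mittagLefflerKernel_zero_index {μ ω t : ℝ} (hμ : 1 ≤ μ) (ht : 0 < t) :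
    mittagLefflerKernel μ ω 0 t = ω * mittagLefflerKernel μ ω μ t := by
  rw [mittagLefflerKernel_recurrence hμ ht, Real.Gamma_zero, div_zero, zero_add, zero_add]

theorem continuousOn_mittagLefflerKernel_shift {μ ω ν : ℝ} (hμ : 1 ≤ μ) (hω : 0 ≤ ω) (hν : 1 ≤ ν)
    {τ : ℝ} (hτ : 0 ≤ τ) (T : ℝ) :
    ContinuousOn (fun u => mittagLefflerKernel μ ω ν (max (u - τ) 0)) (Icc 0 T) :=
  (continuousOn_mittagLefflerKernel hμ hω hν T).comp (by fun_prop) fun u hu =>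
    ⟨le_max_right _ _, max_le (by linarith [hu.2]) (hu.1.trans hu.2)⟩

theorem integral_sub_rpow_mul_mittagLefflerKernel_shift {μ ω ν a τ t : ℝ} (hμ : 1 ≤ μ)
    (hω : 0 ≤ ω) (hν : 1 < ν) (ha : 0 < a) (hτ : 0 ≤ τ) (ht : τ < t) :
    ∫ u in 0..t, (t - u) ^ (a - 1) * mittagLefflerKernel μ ω ν (max (u - τ) 0) =
      Real.Gamma a * mittagLefflerKernel μ ω (ν + a) (t - τ) := by
  have hint (p q : ℝ) (hp : 0 ≤ p) (hpq : p ≤ q) :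
      IntervalIntegrable (fun u => (t - u) ^ (a - 1) * mittagLefflerKernel μ ω ν (max (u - τ) 0))
        volume p q := by
    refine (intervalIntegrable_sub_rpow ha t p q).mul_continuousOn
      ((continuousOn_mittagLefflerKernel_shift hμ hω hν.le hτ q).mono ?_)
    rw [uIcc_of_le hpq]
    exact Icc_subset_Icc_left hp
  rw [← intervalIntegral.integral_add_adjacent_intervals (hint 0 τ le_rfl hτ) (hint τ t hτ ht.le)]
  have h0 : ∫ u in 0..τ, (t - u) ^ (a - 1) * mittagLefflerKernel μ ω ν (max (u - τ) 0) = 0 := by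
    rw [intervalIntegral.integral_congr (g := fun _ => (0 : ℝ)), intervalIntegral.integral_zero]
    intro u hu
    rw [uIcc_of_le hτ] at hu
    simp only
    rw [max_eq_right (by linarith [hu.2]), mittagLefflerKernel_zero_right (by linarith) hν,
      mul_zero]
  have h1 : ∫ u in τ..t, (t - u) ^ (a - 1) * mittagLefflerKernel μ ω ν (max (u - τ) 0) =
      ∫ u in τ..t, (fun v => (t - τ - v) ^ (a - 1) * mittagLefflerKernel μ ω ν v) (u - τ) := by
    refine intervalIntegral.integral_congr fun u hu => ?_
    rw [uIcc_of_le ht.le] at hu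
    simp only
    rw [max_eq_left (by linarith [hu.1]), sub_sub_sub_cancel_right]
  rw [h0, h1, intervalIntegral.integral_comp_sub_right
    (fun v => (t - τ - v) ^ (a - 1) * mittagLefflerKernel μ ω ν v), sub_self, zero_add]
  exact integral_sub_rpow_mul_mittagLefflerKernel hμ hω hν.le ha (sub_pos.2 ht)

/-- Maximum principle for `A E_{μ,1}(ω t^μ) - B (t-τ)_+^(μ-1) E_{μ,μ}(ω (t-τ)_+^μ)`. -/
theorem not_neg_interior_min {μ ω A B τ x T : ℝ} (hμ1 : 1 < μ) (hμ2 : μ ≤ 2) (hω : 0 < ω)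
    (hA : 0 ≤ A) (hτ : 0 ≤ τ) (hx : τ < x) (hxT : x < T)
    (hmin : ∀ u ∈ Icc 0 T,
      A * mittagLefflerKernel μ ω 1 x - B * mittagLefflerKernel μ ω μ (x - τ) ≤
      A * mittagLefflerKernel μ ω 1 u - B * mittagLefflerKernel μ ω μ (max (u - τ) 0)) :
    0 ≤ A * mittagLefflerKernel μ ω 1 x - B * mittagLefflerKernel μ ω μ (x - τ) := by
  have hx0 : 0 < x := hτ.trans_lt hx
  by_contra! hneg
  set m := A * mittagLefflerKernel μ ω 1 x - B * mittagLefflerKernel μ ω μ (x - τ) with hm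
  have hder (ν κ : ℝ) : ∀ᶠ y in 𝓝 x, HasDerivAt
      (fun t => A * mittagLefflerKernel μ ω ν t - B * mittagLefflerKernel μ ω κ (t - τ))
      (A * mittagLefflerKernel μ ω (ν - 1) y - B * mittagLefflerKernel μ ω (κ - 1) (y - τ)) y := by
    filter_upwards [eventually_gt_nhds hx] with y hy
    exact hasDerivAt_mittagLefflerKernel_combination hμ1.le A B ν κ hτ hy
  have hlocmin : IsLocalMin
      (fun t => A * mittagLefflerKernel μ ω 1 t - B * mittagLefflerKernel μ ω μ (t - τ)) x := by
    filter_upwards [eventually_gt_nhds hx, eventually_lt_nhds hxT] with y hy hyT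
    have := hmin y ⟨by linarith, hyT.le⟩
    rwa [max_eq_left (by linarith)] at this
  have hcrit := hlocmin.hasDerivAt_eq_zero (hder 1 μ).self_of_nhds
  rcases hμ2.lt_or_eq with hμ2 | rfl
  · obtain ⟨a, ha, rfl⟩ : ∃ a : ℝ, 0 < a ∧ μ = 2 - a := ⟨2 - μ, by linarith, by ring⟩
    have ha1 : a < 1 := by linarith
    obtain ⟨K, hK0, hK⟩ : ∃ K : ℝ, 0 < K ∧ A * mittagLefflerKernel (2 - a) ω (1 - 1 - 1) x -
        B * mittagLefflerKernel (2 - a) ω (2 - a - 1 - 1) (x - τ) < 2 * K := by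
      obtain ⟨K, hK⟩ := exists_gt (max 0 ((A * mittagLefflerKernel (2 - a) ω (1 - 1 - 1) x -
        B * mittagLefflerKernel (2 - a) ω (2 - a - 1 - 1) (x - τ)) / 2))
      rw [max_lt_iff] at hK
      exact ⟨K, hK.1, (div_lt_iff₀' two_pos).1 hK.2⟩
    have hquad := eventually_sub_le_mul_sq (hder 1 (2 - a))
      (hder (1 - 1) (2 - a - 1)).self_of_nhds hcrit hK
    set P : ℝ → ℝ := fun u => A * mittagLefflerKernel (2 - a) ω 1 u -
      B * mittagLefflerKernel (2 - a) ω (2 - a) (max (u - τ) 0) - m with hP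
    have hcont : ContinuousOn P (Icc 0 T) :=
      (((continuousOn_mittagLefflerKernel hμ1.le hω.le le_rfl T).const_mul A).sub
        ((continuousOn_mittagLefflerKernel_shift hμ1.le hω.le hμ1.le hτ T).const_mul B)).sub
        continuousOn_const
    set J : ℝ → ℝ := fun t => Real.Gamma a * (A * mittagLefflerKernel (2 - a) ω (1 + a) t -
      B * mittagLefflerKernel (2 - a) ω (2 - a + a) (t - τ)) - m * (t ^ a / a) with hJ
    have hJP : ∀ t, τ < t → t ≤ T → ∫ u in 0..t, (t - u) ^ (a - 1) * P u = J t := by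
      intro t ht htT
      have ht0 : 0 < t := hτ.trans_lt ht
      have hi (f : ℝ → ℝ) (hf : ContinuousOn f (Icc 0 T)) :
          IntervalIntegrable (fun u => (t - u) ^ (a - 1) * f u) volume 0 t := by
        refine (intervalIntegrable_sub_rpow ha t 0 t).mul_continuousOn (hf.mono ?_)
        rw [uIcc_of_le ht0.le]
        exact Icc_subset_Icc_right htT
      have hexp (u : ℝ) : (t - u) ^ (a - 1) * P u =
          A * ((t - u) ^ (a - 1) * mittagLefflerKernel (2 - a) ω 1 u) -
          B * ((t - u) ^ (a - 1) * mittagLefflerKernel (2 - a) ω (2 - a) (max (u - τ) 0)) -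
          m * (t - u) ^ (a - 1) := by
        simp only [hP]
        ring
      have i1 := (hi _ (continuousOn_mittagLefflerKernel hμ1.le hω.le le_rfl T)).const_mul A
      have i2 := (hi _ (continuousOn_mittagLefflerKernel_shift hμ1.le hω.le hμ1.le hτ T)).const_mul
        B
      have hpow : ∫ u in 0..t, (t - u) ^ (a - 1) = t ^ a / a := by
        rw [intervalIntegral.integral_comp_sub_left (fun v => v ^ (a - 1)), sub_self, sub_zero,
          integral_rpow (Or.inl (by linarith)), sub_add_cancel, Real.zero_rpow ha.ne', sub_zero]
      simp_rw [hexp]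
      rw [intervalIntegral.integral_sub (i1.sub i2)
          ((intervalIntegrable_sub_rpow ha t 0 t).const_mul m),
        intervalIntegral.integral_sub i1 i2, intervalIntegral.integral_const_mul,
        intervalIntegral.integral_const_mul, intervalIntegral.integral_const_mul, hpow,
        integral_sub_rpow_mul_mittagLefflerKernel hμ1.le hω.le le_rfl ha ht0,
        integral_sub_rpow_mul_mittagLefflerKernel_shift hμ1.le hω.le hμ1 ha hτ ht]
      simp only [hJ]
      ring
    have hJ1 : ∀ᶠ y in 𝓝 x, HasDerivAt J
        (Real.Gamma a * (A * mittagLefflerKernel (2 - a) ω (1 + a - 1) y -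
          B * mittagLefflerKernel (2 - a) ω (2 - a + a - 1) (y - τ)) - m * y ^ (a - 1)) y := by
      filter_upwards [hder (1 + a) (2 - a + a), eventually_gt_nhds hx0] with y hy hy0
      convert! (hy.const_mul (Real.Gamma a)).sub
        (((Real.hasDerivAt_rpow_const (p := a) (Or.inl hy0.ne')).div_const a).const_mul m) using 1
      field_simp
    have hJ2 := ((hder (1 + a - 1) (2 - a + a - 1)).self_of_nhds.const_mul (Real.Gamma a)).sub
      ((Real.hasDerivAt_rpow_const (p := a - 1) (Or.inl hx0.ne')).const_mul m)
    set d := Real.Gamma a * (A * mittagLefflerKernel (2 - a) ω (1 + a - 1 - 1) x -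
      B * mittagLefflerKernel (2 - a) ω (2 - a + a - 1 - 1) (x - τ)) -
      m * ((a - 1) * x ^ (a - 1 - 1)) with hd
    have hdneg : d < 0 := by
      have hG : Real.Gamma a / Real.Gamma (a - 1) = a - 1 := by
        have h := Real.Gamma_add_one (s := a - 1) (by linarith)
        rw [sub_add_cancel] at h
        rw [h, mul_div_cancel_right₀]
        intro h0
        rw [h0, mul_zero] at h
        exact (Real.Gamma_pos_of_pos ha).ne' h
      have hdval : d = (a - 1) * x ^ (a - 1 - 1) * (A - m) + Real.Gamma a * ω * m := by
        rw [hd, show 2 - a + a - 1 - 1 = (0 : ℝ) by ring, show 1 + a - 1 - 1 = a - 1 by ring,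
          mittagLefflerKernel_zero_index hμ1.le (sub_pos.2 hx),
          mittagLefflerKernel_recurrence hμ1.le hx0, show a - 1 + (2 - a) = 1 by ring, hm]
        linear_combination A * x ^ (a - 1 - 1) * hG
      have h1 : (a - 1) * x ^ (a - 1 - 1) * (A - m) ≤ 0 :=
        mul_nonpos_of_nonpos_of_nonneg
          (mul_nonpos_of_nonpos_of_nonneg (by linarith) (Real.rpow_nonneg hx0.le _)) (by linarith)
      have h2 : Real.Gamma a * ω * m < 0 :=
        mul_neg_of_pos_of_neg (mul_pos (Real.Gamma_pos_of_pos ha) hω) hneg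
      linarith
    have hsd := eventually_secondDifference_le hJ1 hJ2 (by linarith : d < d / 2)
    obtain ⟨ε, hε, hball⟩ := Metric.eventually_nhds_iff.1 hquad
    have hsmall : ∀ᶠ δ in 𝓝 (0 : ℝ), 2 * K * (δ ^ a / a) < -(d / 2) := by
      have hcts : Tendsto (fun δ : ℝ => 2 * K * (δ ^ a / a)) (𝓝 0) (𝓝 0) := by
        have := ((Real.continuous_rpow_const ha.le).div_const a).const_mul (2 * K) |>.tendsto 0
        simpa [Real.zero_rpow ha.ne'] using this
      exact hcts.eventually (eventually_lt_nhds (by linarith))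
    obtain ⟨δ, ⟨hδsd, hδs, hδε, hδτ, hδT⟩, hδ0⟩ :=
      ((((hsd.and (hsmall.and ((eventually_lt_nhds hε).and ((eventually_lt_nhds (sub_pos.2 hx)).and
        (eventually_lt_nhds (sub_pos.2 hxT)))))).filter_mono nhdsWithin_le_nhds).and
        (self_mem_nhdsWithin : ∀ᶠ δ in 𝓝[>] (0 : ℝ), δ ∈ Ioi (0 : ℝ)))).exists
    have hlow := neg_le_secondDifference_integral_rpow_mul (M := K * δ ^ 2) ha ha1.le hδ0
      (by linarith : δ ≤ x) (hcont.mono (Icc_subset_Icc_right (by linarith)))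
      (fun u hu => sub_nonneg.2 (hmin u ⟨hu.1, by linarith [hu.2]⟩))
      (fun u hu => by
        have hu' : |u - x| ≤ δ := abs_le.2 ⟨by linarith [hu.1], by linarith [hu.2]⟩
        have h := hball (y := u) (by rw [Real.dist_eq]; linarith)
        simp only [hP]
        rw [max_eq_left (by linarith [hu.1])]
        refine h.trans (mul_le_mul_of_nonneg_left ?_ hK0.le)
        rw [← sq_abs]
        gcongr)
    rw [hJP _ (by linarith) (by linarith), hJP _ (by linarith) (by linarith),
      hJP _ (by linarith) (by linarith)] at hlow
    have := mul_lt_mul_of_pos_right hδs (pow_pos hδ0 2)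
    linarith
  · have hval : A * mittagLefflerKernel 2 ω (1 - 1 - 1) x -
        B * mittagLefflerKernel 2 ω (2 - 1 - 1) (x - τ) = ω * m := by
      have hG : Real.Gamma (-1) = 0 := by simpa using Real.Gamma_neg_nat_eq_zero 1
      rw [show (2 - 1 - 1 : ℝ) = 0 by norm_num, show (1 - 1 - 1 : ℝ) = -1 by norm_num,
        mittagLefflerKernel_zero_index hμ1.le (sub_pos.2 hx),
        mittagLefflerKernel_recurrence hμ1.le hx0, hG, show (-1 + 2 : ℝ) = 1 by norm_num, hm]
      ring
    have hωm : ω * m < 0 := mul_neg_of_pos_of_neg hω hneg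
    have hquad := eventually_sub_le_mul_sq (hder 1 2) (hder (1 - 1) (2 - 1)).self_of_nhds hcrit
      (by rw [hval]; linarith : _ < 2 * (ω * m / 4))
    obtain ⟨y, ⟨hy, hy'⟩, hyx⟩ := (((hquad.and hlocmin).filter_mono nhdsWithin_le_nhds).and
      (self_mem_nhdsWithin : ∀ᶠ y in 𝓝[>] x, y ∈ Ioi x)).exists
    have : 0 < (y - x) ^ 2 := pow_pos (sub_pos.2 hyx) 2
    nlinarith

theorem mittagLefflerKernel_mul_le {μ ω t τ : ℝ} (hμ1 : 1 < μ) (hμ2 : μ ≤ 2) (hω : 0 < ω)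
    (hτ : 0 ≤ τ) (hτt : τ ≤ t) (ht : t ≤ 1) :
    mittagLefflerKernel μ ω 1 1 * mittagLefflerKernel μ ω μ (t - τ) ≤
      mittagLefflerKernel μ ω μ (1 - τ) * mittagLefflerKernel μ ω 1 t := by
  have hnn {ν : ℝ} (hν : 1 ≤ ν) {s : ℝ} (hs : 0 ≤ s) : 0 ≤ mittagLefflerKernel μ ω ν s := by
    rw [mittagLefflerKernel_eq (by linarith) (Or.inr ⟨hs, hν⟩)]
    exact mul_nonneg (Real.rpow_nonneg hs _) (mittagLeffler_nonneg (by linarith) (by linarith)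
      (mul_nonneg hω.le (Real.rpow_nonneg hs _)))
  set A := mittagLefflerKernel μ ω μ (1 - τ)
  set B := mittagLefflerKernel μ ω 1 1
  have hA : 0 ≤ A := hnn hμ1.le (by linarith)
  have hcont : ContinuousOn (fun u => A * mittagLefflerKernel μ ω 1 u -
      B * mittagLefflerKernel μ ω μ (max (u - τ) 0)) (Icc 0 1) :=
    ((continuousOn_mittagLefflerKernel hμ1.le hω.le le_rfl 1).const_mul A).sub
      ((continuousOn_mittagLefflerKernel_shift hμ1.le hω.le hμ1.le hτ 1).const_mul B)
  obtain ⟨x, hx, hmin⟩ := isCompact_Icc.exists_isMinOn (nonempty_Icc.2 zero_le_one) hcont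
  have hmin' := isMinOn_iff.1 hmin
  suffices h : 0 ≤ A * mittagLefflerKernel μ ω 1 x -
      B * mittagLefflerKernel μ ω μ (max (x - τ) 0) by
    have := h.trans (hmin' t ⟨by linarith, ht⟩)
    rw [max_eq_left (by linarith)] at this
    linarith
  rcases le_or_gt x τ with hxτ | hxτ
  · rw [max_eq_right (by linarith), mittagLefflerKernel_zero_right (by linarith) hμ1, mul_zero,
      sub_zero]
    exact mul_nonneg hA (hnn le_rfl hx.1)
  · rw [max_eq_left (by linarith)]
    rcases hx.2.lt_or_eq with hx1 | rfl
    · rw [max_eq_left (by linarith)] at hmin'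
      exact not_neg_interior_min hμ1 hμ2 hω hA hτ hxτ hx1 hmin'
    · simp only [A, B]
      linarith

/-- `0 ≤ G(t,τ) ≤ E_{μ,μ}(ω)` on `[0,1] × [0,1]`. -/
theorem greenG_bounds (μ ω : ℝ) (hμ1 : 1 < μ) (hμ2 : μ ≤ 2) (hω : 0 < ω)
    (t τ : ℝ) (ht : t ∈ Set.Icc (0 : ℝ) 1) (hτ : τ ∈ Set.Icc (0 : ℝ) 1) :
    0 ≤ greenG μ ω t τ ∧ greenG μ ω t τ ≤ mittagLeffler μ μ ω := by
  have hμ0 : 0 < μ := by linarith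
  have hpow {s : ℝ} (hs : 0 ≤ s) : 0 ≤ ω * s ^ μ := mul_nonneg hω.le (Real.rpow_nonneg hs _)
  have hpow_le {s : ℝ} (hs : 0 ≤ s) (hs1 : s ≤ 1) : ω * s ^ μ ≤ ω :=
    mul_le_of_le_one_right hω.le (Real.rpow_le_one hs hs1 hμ0.le)
  have hS {s : ℝ} (hs : 0 ≤ s) : 0 ≤ s ^ (μ - 1) * mittagLeffler μ μ (ω * s ^ μ) :=
    mul_nonneg (Real.rpow_nonneg hs _) (mittagLeffler_nonneg hμ0.le hμ0 (hpow hs))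
  have hC1 : 0 < mittagLeffler μ 1 ω := mittagLeffler_one_pos hμ1.le hω.le
  have hCt : 0 < mittagLeffler μ 1 (ω * t ^ μ) := mittagLeffler_one_pos hμ1.le (hpow ht.1)
  have h1τ : 0 ≤ 1 - τ := by linarith [hτ.2]
  have hmain : 0 ≤ mittagLeffler μ 1 (ω * t ^ μ) / mittagLeffler μ 1 ω *
      ((1 - τ) ^ (μ - 1) * mittagLeffler μ μ (ω * (1 - τ) ^ μ)) :=
    mul_nonneg (div_pos hCt hC1).le (hS h1τ)
  unfold greenG
  constructor
  · split_ifs with h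
    · have hk := mittagLefflerKernel_mul_le hμ1 hμ2 hω hτ.1 h ht.2
      rw [mittagLefflerKernel_eq hμ0.le (Or.inl one_pos),
        mittagLefflerKernel_eq hμ0.le (Or.inr ⟨by linarith, hμ1.le⟩),
        mittagLefflerKernel_eq hμ0.le (Or.inr ⟨h1τ, hμ1.le⟩),
        mittagLefflerKernel_eq hμ0.le (Or.inr ⟨ht.1, le_rfl⟩)] at hk
      simp only [sub_self, Real.rpow_zero, one_mul, Real.one_rpow, mul_one] at hk
      rw [sub_nonneg, div_mul_eq_mul_div, le_div_iff₀ hC1]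
      linarith
    · simpa using hmain
  · have hsub : 0 ≤ (if τ ≤ t then
        (t - τ) ^ (μ - 1) * mittagLeffler μ μ (ω * (t - τ) ^ μ) else 0) := by
      split_ifs with h
      · exact hS (by linarith)
      · exact le_rfl
    have hratio : mittagLeffler μ 1 (ω * t ^ μ) / mittagLeffler μ 1 ω ≤ 1 :=
      (div_le_one hC1).2 (mittagLeffler_mono hμ1.le one_pos (hpow ht.1) (hpow_le ht.1 ht.2))
    have hS1 : (1 - τ) ^ (μ - 1) * mittagLeffler μ μ (ω * (1 - τ) ^ μ) ≤ mittagLeffler μ μ ω :=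
      (mul_le_of_le_one_left (mittagLeffler_nonneg hμ0.le hμ0 (hpow h1τ))
        (Real.rpow_le_one h1τ (by linarith [hτ.1]) (by linarith))).trans
        (mittagLeffler_mono hμ1.le hμ0 (hpow h1τ) (hpow_le h1τ (by linarith [hτ.1])))
    linarith [mul_le_of_le_one_left (hS h1τ) hratio]
end

section
/- Let 1 < μ ≤ 2 and ω > 0, and let G be the Green's function defined as above. Then G(t,τ) > 0 for all (t,τ) ∈ [0,1) × [0,1). -/
open Real

open MeasureTheory

/-- The kernel `x^(ν-1) E_{μ,ν}(x^μ)`, with Laplace transform `p^(μ-ν) / (p^μ - 1)`. -/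
noncomputable def mlKernel (μ ν x : ℝ) : ℝ :=
  x ^ (ν - 1) * mittagLeffler μ ν (x ^ μ)

theorem mittagLeffler_summable_norm {μ ν : ℝ} (hμ : 1 < μ) (hν : 0 ≤ ν) (t : ℝ) :
    Summable fun k : ℕ => ‖t ^ k / Real.Gamma (μ * k + ν)‖ := by
  have hs := (Real.summable_pow_div_factorial t).norm
  refine Summable.of_norm_bounded_eventually_nat hs ?_
  obtain ⟨N, hN⟩ := exists_nat_ge (1 / (μ - 1))
  filter_upwards [Filter.eventually_ge_atTop (max N 1)] with k hk
  have hk1 : (1 : ℝ) ≤ k := by exact_mod_cast le_trans (le_max_right _ _) hk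
  have hkN : (N : ℝ) ≤ k := by exact_mod_cast le_trans (le_max_left _ _) hk
  have h1 : (k : ℝ) + 1 ≤ μ * k + ν := by
    have : 1 ≤ (μ - 1) * k := by
      have := (div_le_iff₀ (by linarith : (0 : ℝ) < μ - 1)).1 (hN.trans hkN)
      linarith
    linarith
  have h2 : Real.Gamma (k + 1) ≤ Real.Gamma (μ * k + ν) :=
    Real.Gamma_strictMonoOn_Ici.monotoneOn (Set.mem_Ici.2 (by linarith))
      (Set.mem_Ici.2 (by linarith)) h1
  rw [Real.Gamma_nat_eq_factorial] at h2
  have h3 : (0 : ℝ) < k.factorial := by exact_mod_cast k.factorial_pos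
  rw [norm_norm, norm_div, norm_div, Real.norm_of_nonneg h3.le,
    Real.norm_of_nonneg (h3.le.trans h2)]
  exact div_le_div_of_nonneg_left (norm_nonneg _) h3 h2

theorem mittagLeffler_analyticAt {μ ν : ℝ} (hμ : 1 < μ) (hν : 0 ≤ ν) (t : ℝ) :
    AnalyticAt ℝ (mittagLeffler μ ν) t := by
  set c : ℕ → ℝ := fun k => 1 / Real.Gamma (μ * k + ν)
  have hr : (FormalMultilinearSeries.ofScalars ℝ c).radius = ⊤ := by
    refine FormalMultilinearSeries.radius_eq_top_of_summable_norm _ fun r => ?_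
    refine (mittagLeffler_summable_norm hμ hν (r : ℝ)).congr fun k => ?_
    rw [FormalMultilinearSeries.ofScalars_norm, norm_div, norm_pow, NNReal.norm_eq]
    simp only [c, norm_div, norm_one]
    ring
  have h := (FormalMultilinearSeries.ofScalars ℝ c).hasFPowerSeriesOnBall (by simp [hr])
  have he : (FormalMultilinearSeries.ofScalars ℝ c).sum = mittagLeffler μ ν := by
    funext x
    have := FormalMultilinearSeries.ofScalars_sum_eq (E := ℝ) c x
    rw [FormalMultilinearSeries.ofScalarsSum] at this
    rw [this, mittagLeffler]
    refine tsum_congr fun k => ?_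
    simp only [c, smul_eq_mul]
    ring
  rw [he] at h
  exact h.analyticAt_of_mem (by simp [hr])

theorem mittagLeffler_pos {μ ν t : ℝ} (hμ : 1 < μ) (hν : 0 < ν) (ht : 0 ≤ t) :
    0 < mittagLeffler μ ν t := by
  refine (mittagLeffler_summable_norm hμ hν.le t).of_norm.tsum_pos (fun k => ?_) 0 ?_
  · have : 0 < Real.Gamma (μ * k + ν) := Real.Gamma_pos_of_pos (by positivity)
    positivity
  · simpa using Real.Gamma_pos_of_pos hν

theorem mlKernel_eq_tsum {μ ν x : ℝ} (hx : 0 < x) :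
    mlKernel μ ν x = ∑' k : ℕ, x ^ (μ * k + ν - 1) / Real.Gamma (μ * k + ν) := by
  rw [mlKernel, mittagLeffler, ← tsum_mul_left]
  refine tsum_congr fun k => ?_
  rw [← Real.rpow_natCast, ← Real.rpow_mul hx.le, mul_div_assoc', ← Real.rpow_add hx]
  ring_nf

theorem mlKernel_summable {μ ν x : ℝ} (hμ : 1 < μ) (hν : 0 ≤ ν) (hx : 0 < x) :
    Summable fun k : ℕ => x ^ (μ * k + ν - 1) / Real.Gamma (μ * k + ν) := by
  refine ((mittagLeffler_summable_norm hμ hν (x ^ μ)).of_norm.mul_left (x ^ (ν - 1))).congr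
    fun k => ?_
  rw [← Real.rpow_natCast, ← Real.rpow_mul hx.le, mul_div_assoc', ← Real.rpow_add hx]
  ring_nf

theorem mlKernel_analyticAt {μ ν x : ℝ} (hμ : 1 < μ) (hν : 0 ≤ ν) (hx : 0 < x) :
    AnalyticAt ℝ (mlKernel μ ν) x := by
  have h (a : ℝ) : AnalyticAt ℝ (fun y : ℝ => y ^ a) x := by
    have h1 : AnalyticAt ℝ (fun y : ℝ => Real.exp (Real.log y * a)) x :=
      ((analyticAt_log hx).mul analyticAt_const).rexp
    refine h1.congr ?_
    filter_upwards [lt_mem_nhds hx] with y hy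
    rw [Real.rpow_def_of_pos hy]
  exact (h _).mul ((mittagLeffler_analyticAt hμ hν _).comp (h μ))

theorem mlKernel_continuousOn {μ ν : ℝ} (hμ : 1 < μ) (hν : 1 ≤ ν) :
    ContinuousOn (mlKernel μ ν) (Set.Ici 0) := by
  have h : Continuous (mittagLeffler μ ν) := continuous_iff_continuousAt.2 fun t =>
    (mittagLeffler_analyticAt hμ (by linarith) t).continuousAt
  have h1 : Continuous fun x : ℝ => x ^ (ν - 1) :=
    Real.continuous_rpow_const (by linarith)
  have h2 : Continuous fun x : ℝ => x ^ μ := Real.continuous_rpow_const (by linarith)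
  exact (h1.mul (h.comp h2)).continuousOn

theorem mlKernel_hasDerivAt {μ ν x : ℝ} (hμ : 1 < μ) (hν : 0 ≤ ν) (hx : 0 < x) :
    HasDerivAt (mlKernel μ (ν + 1)) (mlKernel μ ν x) x := by
  have hu : Summable fun k : ℕ => (x / 2) ^ (μ * k + ν - 1) / Real.Gamma (μ * k + ν) +
      (2 * x) ^ (μ * k + ν - 1) / Real.Gamma (μ * k + ν) :=
    (mlKernel_summable hμ hν (by positivity)).add (mlKernel_summable hμ hν (by positivity))
  have hmem : x ∈ Set.Ioo (x / 2) (2 * x) := ⟨by linarith, by linarith⟩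
  have key := hasDerivAt_tsum_of_isPreconnected (𝕜 := ℝ) hu isOpen_Ioo isPreconnected_Ioo
    (g := fun (k : ℕ) y => y ^ (μ * k + (ν + 1) - 1) / Real.Gamma (μ * k + (ν + 1)))
    (g' := fun (k : ℕ) y => y ^ (μ * k + ν - 1) / Real.Gamma (μ * k + ν))
    (fun k y hy => ?_) (fun k y hy => ?_) hmem (mlKernel_summable hμ (by linarith) hx) hmem
  · rw [← mlKernel_eq_tsum hx] at key
    refine key.congr_of_eventuallyEq ?_
    filter_upwards [lt_mem_nhds hx] with y hy
    exact mlKernel_eq_tsum hy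
  · have hy0 : 0 < y := lt_trans (by positivity) hy.1
    have h := (Real.hasDerivAt_rpow_const (p := μ * k + (ν + 1) - 1) (Or.inl hy0.ne')).div_const
      (Real.Gamma (μ * k + (ν + 1)))
    refine h.congr_deriv (Eq.symm ?_)
    rcases eq_or_ne (μ * k + ν) 0 with h0 | h0
    · have : μ * k + (ν + 1) - 1 = 0 := by linarith
      rw [h0, this]
      simp
    · rw [← add_assoc, Real.Gamma_add_one h0, add_sub_cancel_right,
        mul_div_mul_left _ _ h0]
  · have hy0 : 0 < y := lt_trans (by positivity) hy.1
    have hk : (0 : ℝ) ≤ μ * k := by positivity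
    have hG : 0 ≤ Real.Gamma (μ * k + ν) := Real.Gamma_nonneg_of_nonneg (by positivity)
    rw [Real.norm_of_nonneg (by positivity), ← add_div]
    refine div_le_div_of_nonneg_right ?_ hG
    rcases le_total 0 (μ * k + ν - 1) with h | h
    · have := Real.rpow_le_rpow hy0.le hy.2.le h
      have : 0 ≤ (x / 2) ^ (μ * k + ν - 1) := by positivity
      linarith
    · have := Real.rpow_le_rpow_of_nonpos (by positivity : 0 < x / 2) hy.1.le h
      have : 0 ≤ (2 * x) ^ (μ * k + ν - 1) := by positivity
      linarith

theorem mlKernel_zero {μ x : ℝ} (hμ : 1 < μ) (hx : 0 < x) : mlKernel μ 0 x = mlKernel μ μ x := by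
  rw [mlKernel_eq_tsum hx, mlKernel_eq_tsum hx,
    (mlKernel_summable hμ le_rfl hx).tsum_eq_zero_add]
  simp only [Nat.cast_zero, mul_zero, add_zero, Real.Gamma_zero, div_zero, zero_add]
  refine tsum_congr fun k => ?_
  push_cast
  ring_nf

theorem mlKernel_laplace_term {a p : ℝ} (ha : 0 < a) (hp : 0 < p) :
    IntegrableOn (fun t : ℝ => Real.exp (-(p * t)) * (t ^ (a - 1) / Real.Gamma a)) (Set.Ioi 0) ∧
    ∫ t in Set.Ioi (0 : ℝ), Real.exp (-(p * t)) * (t ^ (a - 1) / Real.Gamma a) = (1 / p) ^ a := by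
  have hG := Real.Gamma_pos_of_pos ha
  have h : ∫ t in Set.Ioi (0 : ℝ), Real.exp (-(p * t)) * (t ^ (a - 1) / Real.Gamma a) =
      (1 / p) ^ a := by
    rw [← mul_div_cancel_right₀ ((1 / p) ^ a) hG.ne', ← Real.integral_rpow_mul_exp_neg_mul_Ioi ha hp,
      ← integral_div]
    congr 1
    funext t
    ring
  refine ⟨Integrable.of_integral_ne_zero ?_, h⟩
  rw [h]
  positivity

/-- Laplace transform of `mlKernel`. -/
theorem mlKernel_laplace {μ ν p : ℝ} (hμ : 1 < μ) (hν : 0 < ν) (hp : 1 < p) :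
    IntegrableOn (fun t : ℝ => Real.exp (-(p * t)) * mlKernel μ ν t) (Set.Ioi 0) ∧
    ∫ t in Set.Ioi (0 : ℝ), Real.exp (-(p * t)) * mlKernel μ ν t = p ^ (μ - ν) / (p ^ μ - 1) := by
  have hp0 : 0 < p := by linarith
  have ha (k : ℕ) : 0 < μ * k + ν := by positivity
  have hpμ : 1 < p ^ μ := Real.one_lt_rpow hp (by linarith)
  have hgeo : HasSum (fun k : ℕ => (1 / p) ^ (μ * k + ν)) (p ^ (μ - ν) / (p ^ μ - 1)) := by
    have h1 := (hasSum_geometric_of_lt_one (r := (p ^ μ)⁻¹) (by positivity)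
      (inv_lt_one_of_one_lt₀ hpμ)).mul_left ((p ^ ν)⁻¹)
    have e : (p ^ ν)⁻¹ * (1 - (p ^ μ)⁻¹)⁻¹ = p ^ (μ - ν) / (p ^ μ - 1) := by
      rw [Real.rpow_sub hp0]
      have : p ^ μ - 1 ≠ 0 := by linarith
      have : 0 < p ^ ν := by positivity
      have : 0 < p ^ μ := by positivity
      have : 1 - (p ^ μ)⁻¹ ≠ 0 := (sub_pos.2 (inv_lt_one_of_one_lt₀ hpμ)).ne'
      field_simp
    rw [e] at h1
    have e' : (fun k : ℕ => (1 / p) ^ (μ * k + ν)) = fun k => (p ^ ν)⁻¹ * (p ^ μ)⁻¹ ^ k := by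
      funext k
      rw [one_div, Real.inv_rpow hp0.le, Real.rpow_add hp0, Real.rpow_mul hp0.le,
        Real.rpow_natCast, mul_inv, inv_pow]
      ring
    rwa [e']
  have hs := hasSum_integral_of_summable_integral_norm (μ := volume.restrict (Set.Ioi (0 : ℝ)))
    (F := fun (k : ℕ) (t : ℝ) =>
      Real.exp (-(p * t)) * (t ^ (μ * k + ν - 1) / Real.Gamma (μ * k + ν)))
    (fun k => (mlKernel_laplace_term (ha k) hp0).1) (by
      refine hgeo.summable.congr fun k => ?_
      rw [← (mlKernel_laplace_term (ha k) hp0).2]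
      refine setIntegral_congr_fun measurableSet_Ioi fun t ht => ?_
      have : 0 < Real.Gamma (μ * k + ν) := Real.Gamma_pos_of_pos (ha k)
      have ht' : (0 : ℝ) < t := ht
      exact (Real.norm_of_nonneg (by positivity)).symm)
  have h : ∫ t in Set.Ioi (0 : ℝ), Real.exp (-(p * t)) * mlKernel μ ν t =
      p ^ (μ - ν) / (p ^ μ - 1) := by
    rw [← hgeo.tsum_eq, ← tsum_congr fun k => (mlKernel_laplace_term (ha k) hp0).2, hs.tsum_eq]
    refine setIntegral_congr_fun measurableSet_Ioi fun t ht => ?_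
    rw [mlKernel_eq_tsum ht, tsum_mul_left]
  refine ⟨Integrable.of_integral_ne_zero ?_, h⟩
  rw [h]
  have : 0 < p ^ μ - 1 := by linarith
  positivity

/-- Unit-step backward difference `F(p) - F(p+1)`. -/
def stepDiff (F : ℝ → ℝ) (p : ℝ) : ℝ := F p - F (p + 1)

/-- `F` and its first `n` iterated differences are nonnegative on `(1, ∞)`. -/
def CompletelyMonotone : ℕ → (ℝ → ℝ) → Prop
  | 0, F => ∀ p, 1 < p → 0 ≤ F p
  | n + 1, F => (∀ p, 1 < p → 0 ≤ F p) ∧ CompletelyMonotone n (stepDiff F)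

namespace CompletelyMonotone

theorem nonneg {n : ℕ} {F : ℝ → ℝ} (h : CompletelyMonotone n F) {p : ℝ} (hp : 1 < p) :
    0 ≤ F p := by
  cases n with
  | zero => exact h p hp
  | succ n => exact h.1 p hp

theorem congr {n : ℕ} {F G : ℝ → ℝ} (h : CompletelyMonotone n F)
    (hFG : ∀ p, 1 < p → G p = F p) : CompletelyMonotone n G := by
  induction n generalizing F G with
  | zero => exact fun p hp => hFG p hp ▸ h p hp
  | succ n ih =>
    refine ⟨fun p hp => hFG p hp ▸ h.1 p hp, ih h.2 fun p hp => ?_⟩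
    rw [stepDiff, stepDiff, hFG p hp, hFG (p + 1) (by linarith)]

theorem of_succ {n : ℕ} {F : ℝ → ℝ} (h : CompletelyMonotone (n + 1) F) :
    CompletelyMonotone n F := by
  induction n generalizing F with
  | zero => exact h.1
  | succ n ih => exact ⟨h.1, ih h.2⟩

theorem shift {n : ℕ} {F : ℝ → ℝ} (h : CompletelyMonotone n F) :
    CompletelyMonotone n fun p => F (p + 1) := by
  induction n generalizing F with
  | zero => exact fun p hp => h _ (by linarith)
  | succ n ih => exact ⟨fun p hp => h.1 _ (by linarith), ih h.2⟩

theorem add {n : ℕ} {F G : ℝ → ℝ} (hF : CompletelyMonotone n F) (hG : CompletelyMonotone n G) :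
    CompletelyMonotone n fun p => F p + G p := by
  induction n generalizing F G with
  | zero => exact fun p hp => add_nonneg (hF p hp) (hG p hp)
  | succ n ih =>
    refine ⟨fun p hp => add_nonneg (hF.1 p hp) (hG.1 p hp), (ih hF.2 hG.2).congr fun p _ => ?_⟩
    simp only [stepDiff]
    ring

theorem mul {n : ℕ} {F G : ℝ → ℝ} (hF : CompletelyMonotone n F) (hG : CompletelyMonotone n G) :
    CompletelyMonotone n fun p => F p * G p := by
  induction n generalizing F G with
  | zero => exact fun p hp => mul_nonneg (hF p hp) (hG p hp)
  | succ n ih =>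
    refine ⟨fun p hp => mul_nonneg (hF.1 p hp) (hG.1 p hp),
      ((ih hF.2 hG.of_succ).add (ih hF.of_succ.shift hG.2)).congr fun p _ => ?_⟩
    simp only [stepDiff]
    ring

/-- The reciprocal of a positive function with completely monotone increments. -/
theorem inv {n : ℕ} {b : ℝ → ℝ} (hb : ∀ p, 1 < p → 0 < b p)
    (h : CompletelyMonotone n fun p => b (p + 1) - b p) :
    CompletelyMonotone n fun p => (b p)⁻¹ := by
  induction n with
  | zero => exact fun p hp => (inv_pos.2 (hb p hp)).le
  | succ n ih =>
    have hi := ih h.of_succ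
    refine ⟨fun p hp => (inv_pos.2 (hb p hp)).le,
      ((h.of_succ.mul hi).mul hi.shift).congr fun p hp => ?_⟩
    have h1 := (hb p hp).ne'
    have h2 := (hb (p + 1) (by linarith)).ne'
    simp only [stepDiff]
    field_simp

theorem const_nonneg {c : ℝ} (hc : 0 ≤ c) (n : ℕ) : CompletelyMonotone n fun _ => c := by
  induction n generalizing c with
  | zero => exact fun _ _ => hc
  | succ n ih => exact ⟨fun _ _ => hc, (ih le_rfl).congr fun p _ => by simp [stepDiff]⟩

theorem integral {α : Type*} [MeasurableSpace α] {m : Measure α} {s : Set α}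
    (hs : MeasurableSet s) {n : ℕ} {G : α → ℝ → ℝ}
    (hint : ∀ p, 1 < p → IntegrableOn (fun a => G a p) s m)
    (h : ∀ a ∈ s, CompletelyMonotone n (G a)) :
    CompletelyMonotone n fun p => ∫ a in s, G a p ∂m := by
  have h0 : ∀ p, 1 < p → 0 ≤ ∫ a in s, G a p ∂m := fun p hp =>
    setIntegral_nonneg hs fun a ha => (h a ha).nonneg hp
  induction n generalizing G with
  | zero => exact h0
  | succ n ih =>
    have hd : ∀ p, 1 < p → IntegrableOn (fun a => stepDiff (G a) p) s m := fun p hp =>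
      (hint p hp).sub (hint (p + 1) (by linarith))
    refine ⟨h0, (ih hd (fun a ha => (h a ha).2) fun p hp =>
      setIntegral_nonneg hs fun a ha => (h a ha).2.nonneg hp).congr fun p hp => ?_⟩
    exact (integral_sub (hint p hp) (hint (p + 1) (by linarith))).symm

theorem exp_neg_mul {c : ℝ} (hc : 0 ≤ c) (n : ℕ) :
    CompletelyMonotone n fun p => Real.exp (-(c * p)) := by
  induction n with
  | zero => exact fun p _ => (Real.exp_pos _).le
  | succ n ih =>
    have h : 0 ≤ 1 - Real.exp (-c) := by
      have := Real.exp_le_one_iff.2 (neg_nonpos.2 hc)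
      linarith
    refine ⟨fun p _ => (Real.exp_pos _).le, ((const_nonneg h n).mul ih).congr fun p _ => ?_⟩
    rw [stepDiff, mul_add, mul_one, neg_add, Real.exp_add]
    ring

theorem rpow_neg {s u θ : ℝ} (hs : 0 ≤ s) (hθ : 0 ≤ θ) (hu : 0 < u + θ) (n : ℕ) :
    CompletelyMonotone n fun p => (u + θ * p) ^ (-s) := by
  rcases hs.eq_or_lt with rfl | hs
  · simpa using const_nonneg zero_le_one n
  have hpos (p : ℝ) (hp : 1 < p) : 0 < u + θ * p := by nlinarith
  have hI := integral (m := volume) (measurableSet_Ioi (a := (0 : ℝ))) (n := n)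
    (G := fun t p => Real.exp (-((u + θ * p) * t)) * (t ^ (s - 1) / Real.Gamma s))
    (fun p hp => (mlKernel_laplace_term hs (hpos p hp)).1) (fun t ht => by
      have ht' : (0 : ℝ) < t := ht
      have hG := Real.Gamma_pos_of_pos hs
      have hc : 0 ≤ Real.exp (-(u * t)) * (t ^ (s - 1) / Real.Gamma s) := by positivity
      refine ((const_nonneg hc n).mul
        (exp_neg_mul (mul_nonneg hθ ht'.le) n)).congr fun p _ => ?_
      rw [show -((u + θ * p) * t) = -(u * t) + -(θ * t * p) by ring, Real.exp_add]
      ring)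
  refine hI.congr fun p hp => ?_
  rw [(mlKernel_laplace_term hs (hpos p hp)).2, one_div, Real.inv_rpow (hpos p hp).le,
    Real.rpow_neg (hpos p hp).le]

end CompletelyMonotone

theorem rpow_add_sub_rpow_eq_integral {y d β : ℝ} (hy : 0 < y) (hd : 0 ≤ d) :
    IntegrableOn (fun v => β * d * (y + d * v) ^ (β - 1)) (Set.Ioc 0 1) ∧
    ∫ v in Set.Ioc (0 : ℝ) 1, β * d * (y + d * v) ^ (β - 1) = (y + d) ^ β - y ^ β := by
  have hpos (v : ℝ) (hv : v ∈ Set.uIcc (0 : ℝ) 1) : 0 < y + d * v := by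
    rw [Set.uIcc_of_le zero_le_one] at hv
    have := mul_nonneg hd hv.1
    linarith
  have hi : IntervalIntegrable (fun v => β * d * (y + d * v) ^ (β - 1)) volume 0 1 := by
    refine ContinuousOn.intervalIntegrable ?_
    refine ContinuousOn.mul continuousOn_const (ContinuousOn.rpow_const (by fun_prop) ?_)
    exact fun v hv => Or.inl (hpos v hv).ne'
  refine ⟨(intervalIntegrable_iff_integrableOn_Ioc_of_le zero_le_one).1 hi, ?_⟩
  rw [← intervalIntegral.integral_of_le zero_le_one,
    intervalIntegral.integral_eq_sub_of_hasDerivAt (f := fun v => (y + d * v) ^ β) _ hi]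
  · simp
  · intro v hv
    have h := (((hasDerivAt_id v).const_mul d).const_add y).rpow_const (p := β)
      (Or.inl (hpos v hv).ne')
    refine h.congr_deriv ?_
    rw [id]
    ring

theorem completelyMonotone_rpow_sub_one_div {α : ℝ} (h0 : 0 ≤ α) (h1 : α ≤ 1) (n : ℕ) :
    CompletelyMonotone n fun p => (p ^ α - 1) / (p - 1) := by
  have key (p : ℝ) (hp : 1 < p) := rpow_add_sub_rpow_eq_integral (y := 1) (d := p - 1) (β := α)
    one_pos (by linarith)
  have hG (p : ℝ) (hp : 1 < p) (θ : ℝ) : α * (p - 1) * (1 + (p - 1) * θ) ^ (α - 1) / (p - 1) =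
      α * (1 - θ + θ * p) ^ (-(1 - α)) := by
    have : p - 1 ≠ 0 := by linarith
    rw [show 1 + (p - 1) * θ = 1 - θ + θ * p by ring, neg_sub]
    field_simp
  have hI := CompletelyMonotone.integral (m := volume) (measurableSet_Ioc (a := (0 : ℝ)) (b := 1)) (n := n)
    (G := fun θ p => α * (1 - θ + θ * p) ^ (-(1 - α)))
    (fun p hp => IntegrableOn.congr_fun ((key p hp).1.div_const (p - 1))
      (fun θ _ => hG p hp θ) measurableSet_Ioc)
    (fun θ hθ => (CompletelyMonotone.const_nonneg h0 n).mul
      (CompletelyMonotone.rpow_neg (by linarith) hθ.1.le (by linarith) n))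
  refine hI.congr fun p hp => ?_
  have h := (key p hp).2
  rw [add_sub_cancel, Real.one_rpow] at h
  rw [← h, ← integral_div]
  exact integral_congr_ae (Filter.Eventually.of_forall fun θ => hG p hp θ)

theorem completelyMonotone_rpow_increment {α u θ : ℝ} (h0 : 0 ≤ α) (h1 : α ≤ 1) (hθ : 0 ≤ θ)
    (hu : 0 < u + θ) (n : ℕ) :
    CompletelyMonotone n fun p => (u + θ * (p + 1)) ^ α - (u + θ * p) ^ α := by
  have hpos (p : ℝ) (hp : 1 < p) : 0 < u + θ * p := by nlinarith
  have key (p : ℝ) (hp : 1 < p) := rpow_add_sub_rpow_eq_integral (d := θ) (β := α)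
    (hpos p hp) hθ
  have hI := CompletelyMonotone.integral (m := volume) (measurableSet_Ioc (a := (0 : ℝ)) (b := 1)) (n := n)
    (G := fun v p => α * θ * (u + θ * p + θ * v) ^ (α - 1)) (fun p hp => (key p hp).1)
    (fun v hv => by
      have hv' := mul_nonneg hθ hv.1.le
      refine ((CompletelyMonotone.const_nonneg (mul_nonneg h0 hθ) n).mul (CompletelyMonotone.rpow_neg (s := 1 - α) (u := u + θ * v)
        (by linarith) hθ (by linarith) n)).congr fun p _ => ?_
      rw [neg_sub]
      ring_nf)
  refine hI.congr fun p hp => ?_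
  rw [(key p hp).2]
  ring_nf

theorem completelyMonotone_sub_one_div_rpow {μ : ℝ} (h1 : 1 < μ) (h2 : μ ≤ 2) (n : ℕ) :
    CompletelyMonotone n fun p => (p - 1) / (p ^ μ - 1) := by
  have key (p : ℝ) (hp : 1 < p) := rpow_add_sub_rpow_eq_integral (y := 1) (d := p - 1) (β := μ)
    one_pos (by linarith)
  have hG (p : ℝ) (hp : 1 < p) (θ : ℝ) : μ * (p - 1) * (1 + (p - 1) * θ) ^ (μ - 1) / (p - 1) =
      μ * (1 - θ + θ * p) ^ (μ - 1) := by
    have : p - 1 ≠ 0 := by linarith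
    rw [show 1 + (p - 1) * θ = 1 - θ + θ * p by ring]
    field_simp
  have hint (p : ℝ) (hp : 1 < p) :
      IntegrableOn (fun θ => μ * (1 - θ + θ * p) ^ (μ - 1)) (Set.Ioc 0 1) :=
    IntegrableOn.congr_fun ((key p hp).1.div_const (p - 1)) (fun θ _ => hG p hp θ) measurableSet_Ioc
  have hval (p : ℝ) (hp : 1 < p) : (p ^ μ - 1) / (p - 1) =
      ∫ θ in Set.Ioc (0 : ℝ) 1, μ * (1 - θ + θ * p) ^ (μ - 1) := by
    have h := (key p hp).2
    rw [add_sub_cancel, Real.one_rpow] at h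
    rw [← h, ← integral_div]
    exact integral_congr_ae (Filter.Eventually.of_forall fun θ => hG p hp θ)
  have hI := CompletelyMonotone.integral (m := volume) (measurableSet_Ioc (a := (0 : ℝ)) (b := 1)) (n := n)
    (G := fun θ p => μ * (1 - θ + θ * (p + 1)) ^ (μ - 1) - μ * (1 - θ + θ * p) ^ (μ - 1))
    (fun p hp => (hint (p + 1) (by linarith)).sub (hint p hp))
    (fun θ hθ => ((CompletelyMonotone.const_nonneg (by linarith : 0 ≤ μ) n).mul
      (completelyMonotone_rpow_increment (α := μ - 1) (u := 1 - θ) (by linarith) (by linarith)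
        hθ.1.le (by linarith) n)).congr fun p _ => by ring)
  have hinv := CompletelyMonotone.inv (n := n) (b := fun p => (p ^ μ - 1) / (p - 1))
    (fun p hp => div_pos (sub_pos.2 (Real.one_lt_rpow hp (by linarith))) (by linarith))
    (hI.congr fun p hp => by
      rw [integral_sub (hint (p + 1) (by linarith)) (hint p hp), hval p hp,
        hval (p + 1) (by linarith)])
  exact hinv.congr fun p _ => (inv_div _ _).symm

theorem completelyMonotone_rpow_sub_one_div_rpow {μ : ℝ} (h1 : 1 < μ) (h2 : μ ≤ 2) (n : ℕ) :
    CompletelyMonotone n fun p => (p ^ (μ - 1) - 1) / (p ^ μ - 1) :=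
  ((completelyMonotone_rpow_sub_one_div (α := μ - 1) (by linarith) (by linarith) n).mul
    (completelyMonotone_sub_one_div_rpow h1 h2 n)).congr fun p hp =>
      (div_mul_div_cancel₀ (by linarith)).symm

theorem CompletelyMonotone.laplace_weight_nonneg {n : ℕ} {d F : ℝ → ℝ}
    (hF : ∀ p, 1 < p → IntegrableOn (fun t => Real.exp (-(p * t)) * d t) (Set.Ioi 0) ∧
      ∫ t in Set.Ioi (0 : ℝ), Real.exp (-(p * t)) * d t = F p)
    (h : CompletelyMonotone n F) {p : ℝ} (hp : 1 < p) :
    IntegrableOn (fun t => Real.exp (-(p * t)) * ((1 - Real.exp (-t)) ^ n * d t)) (Set.Ioi 0) ∧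
    0 ≤ ∫ t in Set.Ioi (0 : ℝ), Real.exp (-(p * t)) * ((1 - Real.exp (-t)) ^ n * d t) := by
  induction n generalizing d F with
  | zero =>
    simp only [pow_zero, one_mul]
    exact ⟨(hF p hp).1, (hF p hp).2 ▸ h.nonneg hp⟩
  | succ n ih =>
    have key (q : ℝ) : (fun t => Real.exp (-(q * t)) * ((1 - Real.exp (-t)) * d t)) =
        fun t => Real.exp (-(q * t)) * d t - Real.exp (-((q + 1) * t)) * d t := by
      funext t
      rw [show -((q + 1) * t) = -(q * t) + -t by ring, Real.exp_add]
      ring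
    have := ih (d := fun t => (1 - Real.exp (-t)) * d t) (F := stepDiff F) (fun q hq => by
      have h1 := hF q hq
      have h2 := hF (q + 1) (by linarith)
      rw [key]
      refine ⟨h1.1.sub h2.1, ?_⟩
      rw [integral_sub h1.1 h2.1, h1.2, h2.2, stepDiff]) h.2
    simpa only [pow_succ, mul_assoc] using this

/-- A function whose Laplace transform is completely monotone is nonnegative. -/
theorem nonneg_of_laplace_completelyMonotone {d F : ℝ → ℝ} (hd : ContinuousOn d (Set.Ioi 0))
    (hF : ∀ p, 1 < p → IntegrableOn (fun t => Real.exp (-(p * t)) * d t) (Set.Ioi 0) ∧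
      ∫ t in Set.Ioi (0 : ℝ), Real.exp (-(p * t)) * d t = F p)
    (h : ∀ n, CompletelyMonotone n F) {x : ℝ} (hx : 0 < x) : 0 ≤ d x := by
  set X : ℝ → unitInterval := fun t => Set.projIcc 0 1 zero_le_one (Real.exp (-t)) with hX
  have hXc : Continuous X := continuous_projIcc.comp (by fun_prop)
  have hXv (t : ℝ) (ht : 0 < t) : (X t : ℝ) = Real.exp (-t) := by
    have hm : Real.exp (-t) ∈ Set.Icc (0 : ℝ) 1 :=
      ⟨(Real.exp_pos _).le, Real.exp_le_one_iff.2 (by linarith)⟩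
    simp only [hX, Set.projIcc_of_mem zero_le_one hm]
  set w : ℝ → ℝ := fun t => Real.exp (-(2 * t)) * d t with hw
  have hwi : IntegrableOn w (Set.Ioi 0) := (hF 2 (by norm_num)).1
  have hfi (f : C(unitInterval, ℝ)) : IntegrableOn (fun t => f (X t) * w t) (Set.Ioi 0) :=
    hwi.bdd_mul (f.continuous.comp hXc).aestronglyMeasurable
      (Filter.Eventually.of_forall fun t => f.norm_coe_le_norm (X t))
  have hbern (n k : ℕ) : 0 ≤ ∫ t in Set.Ioi (0 : ℝ), bernstein n k (X t) * w t := by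
    have h1 := ((h (n - k)).laplace_weight_nonneg hF
      (p := 2 + k) (by have := k.cast_nonneg (α := ℝ); linarith)).2
    have h2 := mul_nonneg (n.choose k).cast_nonneg (α := ℝ) h1
    rw [← integral_const_mul] at h2
    refine h2.trans_eq (setIntegral_congr_fun measurableSet_Ioi fun t ht => ?_)
    simp only [bernstein_apply, hXv t ht, hw]
    rw [show -((2 + (k : ℝ)) * t) = -(2 * t) + k * -t by ring, Real.exp_add, Real.exp_nat_mul]
    ring
  have hpos (f : C(unitInterval, ℝ)) (hf : ∀ s, 0 ≤ f s) :
      0 ≤ ∫ t in Set.Ioi (0 : ℝ), f (X t) * w t := by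
    have hB := bernsteinApproximation_uniform f
    have hlim : Filter.Tendsto
        (fun n => ∫ t in Set.Ioi (0 : ℝ), bernsteinApproximation n f (X t) * w t) Filter.atTop
        (nhds (∫ t in Set.Ioi (0 : ℝ), f (X t) * w t)) := by
      refine tendsto_integral_filter_of_dominated_convergence (fun t => (‖f‖ + 1) * ‖w t‖)
        (Filter.Eventually.of_forall fun n => (hfi _).aestronglyMeasurable) ?_
        (hwi.norm.const_mul _) (Filter.Eventually.of_forall fun t => ?_)
      · filter_upwards [hB.norm.eventually_le_const (lt_add_one ‖f‖)] with n hn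
        refine Filter.Eventually.of_forall fun t => ?_
        rw [norm_mul]
        gcongr
        exact (ContinuousMap.norm_coe_le_norm _ _).trans hn
      · exact (((continuous_eval_const (X t)).tendsto f).comp hB).mul_const _
    refine ge_of_tendsto' hlim fun n => ?_
    have e (t : ℝ) : bernsteinApproximation n f (X t) * w t =
        ∑ k : Fin (n + 1), f (bernstein.z k) * (bernstein n k (X t) * w t) := by
      rw [bernsteinApproximation.apply, Finset.sum_mul]
      refine Finset.sum_congr rfl fun k _ => ?_
      rw [smul_eq_mul]
      ring
    simp only [e]
    rw [integral_finsetSum _ fun (k : Fin (n + 1)) _ => (hfi (bernstein n k)).const_mul _]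
    refine Finset.sum_nonneg fun k _ => ?_
    rw [integral_const_mul]
    exact mul_nonneg (hf _) (hbern n k)
  by_contra! hneg
  have hcx : ContinuousAt d x := hd.continuousAt (Ioi_mem_nhds hx)
  obtain ⟨ε, hε, hball⟩ := Metric.eventually_nhds_iff.1
    ((hcx.eventually_lt_const hneg).and (lt_mem_nhds hx))
  set φ : C(unitInterval, ℝ) := ⟨fun s =>
    max 0 (((s : ℝ) - Real.exp (-(x + ε))) * (Real.exp (-(x - ε)) - s)), by fun_prop⟩ with hφ
  have hφ0 (s : unitInterval) : 0 ≤ φ s := le_max_left _ _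
  have hin (t : ℝ) (ht : 0 < t) (hne : φ (X t) ≠ 0) : d t < 0 := by
    refine (hball ?_).1
    rw [Real.dist_eq, abs_lt]
    by_contra hcon
    apply hne
    simp only [hφ, ContinuousMap.coe_mk, hXv t ht]
    refine max_eq_left ?_
    rcases not_and_or.1 hcon with h1 | h1
    · refine mul_nonpos_of_nonneg_of_nonpos (sub_nonneg.2 (Real.exp_le_exp.2 ?_))
        (sub_nonpos.2 (Real.exp_le_exp.2 ?_)) <;> linarith
    · refine mul_nonpos_of_nonpos_of_nonneg (sub_nonpos.2 (Real.exp_le_exp.2 ?_))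
        (sub_nonneg.2 (Real.exp_le_exp.2 ?_)) <;> linarith
  have hle (t : ℝ) (ht : 0 < t) : 0 ≤ -(φ (X t) * w t) := by
    by_cases hz : φ (X t) = 0
    · simp [hz]
    · have h1 := hin t ht hz
      have h2 : w t ≤ 0 := mul_nonpos_of_nonneg_of_nonpos (Real.exp_pos _).le h1.le
      exact neg_nonneg.2 (mul_nonpos_of_nonneg_of_nonpos (hφ0 _) h2)
  have hsupp : Set.Ioo (x - ε) (x + ε) ⊆
      Function.support (fun t => -(φ (X t) * w t)) ∩ Set.Ioi 0 := by
    intro t ht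
    have hb := hball (y := t) (by rw [Real.dist_eq, abs_lt]; constructor <;> linarith [ht.1, ht.2])
    refine ⟨?_, hb.2⟩
    have h1 : 0 < φ (X t) := by
      simp only [hφ, ContinuousMap.coe_mk, hXv t hb.2]
      refine lt_max_of_lt_right (mul_pos (sub_pos.2 (Real.exp_lt_exp.2 ?_))
        (sub_pos.2 (Real.exp_lt_exp.2 ?_))) <;> linarith [ht.1, ht.2]
    have h2 : w t ≠ 0 := mul_ne_zero (Real.exp_pos _).ne' hb.1.ne
    exact neg_ne_zero.2 (mul_ne_zero h1.ne' h2)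
  have hint := (setIntegral_pos_iff_support_of_nonneg_ae
    (ae_restrict_of_forall_mem measurableSet_Ioi hle) (hfi φ).neg).2
    (lt_of_lt_of_le (by rw [Real.volume_Ioo]; simpa using hε) (measure_mono hsupp))
  have := hpos φ hφ0
  rw [integral_neg] at hint
  linarith

theorem mlKernel_sub_nonneg {μ ν x : ℝ} (h1 : 1 < μ) (hν : 0 < ν)
    (hcm : ∀ n, CompletelyMonotone n fun p => (p ^ (μ - ν) - 1) / (p ^ μ - 1)) (hx : 0 < x) :
    0 ≤ mlKernel μ ν x - mlKernel μ μ x := by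
  have hμ0 : 0 < μ := by linarith
  refine nonneg_of_laplace_completelyMonotone (d := fun y => mlKernel μ ν y - mlKernel μ μ y)
    (fun y hy => ((mlKernel_analyticAt h1 hν.le hy).sub
      (mlKernel_analyticAt h1 hμ0.le hy)).continuousAt.continuousWithinAt)
    (fun p hp => ?_) hcm hx
  have ha := mlKernel_laplace h1 hν hp
  have hb := mlKernel_laplace h1 hμ0 hp
  simp only [mul_sub]
  refine ⟨ha.1.sub hb.1, ?_⟩
  rw [integral_sub ha.1 hb.1, ha.2, hb.2, sub_self, Real.rpow_zero, sub_div]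

theorem mlKernel_le_deriv {μ x : ℝ} (h1 : 1 < μ) (h2 : μ ≤ 2) (hx : 0 < x) :
    mlKernel μ μ x ≤ mlKernel μ (μ - 1) x := by
  refine sub_nonneg.1 (mlKernel_sub_nonneg h1 (by linarith) (fun n => ?_) hx)
  simpa using completelyMonotone_sub_one_div_rpow h1 h2 n

theorem mlKernel_one_hasDerivAt {μ x : ℝ} (h1 : 1 < μ) (hx : 0 < x) :
    HasDerivAt (mlKernel μ 1) (mlKernel μ μ x) x := by
  have h := mlKernel_hasDerivAt h1 le_rfl hx
  rwa [zero_add, mlKernel_zero h1 hx] at h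

theorem mlKernel_self_hasDerivAt {μ x : ℝ} (h1 : 1 < μ) (hx : 0 < x) :
    HasDerivAt (mlKernel μ μ) (mlKernel μ (μ - 1) x) x := by
  have h := mlKernel_hasDerivAt (ν := μ - 1) h1 (by linarith) hx
  rwa [sub_add_cancel] at h

theorem mlKernel_one {μ x : ℝ} : mlKernel μ 1 x = mittagLeffler μ 1 (x ^ μ) := by
  simp [mlKernel]

theorem mlKernel_self_lt {μ x : ℝ} (h1 : 1 < μ) (h2 : μ ≤ 2) (hx : 0 < x) :
    mlKernel μ μ x < mlKernel μ 1 x := by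
  have hμ0 : 0 < μ := by linarith
  set g : ℝ → ℝ := fun y => mlKernel μ 1 y - mlKernel μ μ y with hg
  have hnn (y : ℝ) (hy : 0 < y) : 0 ≤ g y :=
    mlKernel_sub_nonneg h1 one_pos (completelyMonotone_rpow_sub_one_div_rpow h1 h2) hy
  have hderiv (y : ℝ) (hy : 0 < y) : HasDerivAt g (mlKernel μ μ y - mlKernel μ (μ - 1) y) y :=
    (mlKernel_one_hasDerivAt h1 hy).sub (mlKernel_self_hasDerivAt h1 hy)
  have hanti : AntitoneOn g (Set.Ioi 0) := by
    refine antitoneOn_of_deriv_nonpos (convex_Ioi 0)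
      (fun y hy => (hderiv y hy).continuousAt.continuousWithinAt) ?_ ?_
    · rw [interior_Ioi]
      exact fun y hy => (hderiv y hy).differentiableAt.differentiableWithinAt
    · rw [interior_Ioi]
      intro y hy
      rw [(hderiv y hy).deriv]
      exact sub_nonpos.2 (mlKernel_le_deriv h1 h2 hy)
  refine sub_pos.1 ((hnn x hx).lt_of_ne' fun h0 => ?_)
  have hev : g =ᶠ[nhds (x + 1)] fun _ => 0 := by
    filter_upwards [lt_mem_nhds (lt_add_one x)] with y hy
    exact le_antisymm ((hanti hx (hx.trans hy) hy.le).trans_eq h0) (hnn y (hx.trans hy))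
  have heq : Set.EqOn g (fun _ => 0) (Set.Ioi 0) :=
    AnalyticOnNhd.eqOn_of_preconnected_of_eventuallyEq
      (fun y hy => (mlKernel_analyticAt h1 zero_le_one hy).sub (mlKernel_analyticAt h1 hμ0.le hy))
      (fun _ _ => analyticAt_const) isPreconnected_Ioi (Set.mem_Ioi.2 (by linarith)) hev
  have hc : ContinuousWithinAt g (Set.Ioi 0) 0 :=
    (((mlKernel_continuousOn h1 le_rfl).sub (mlKernel_continuousOn h1 h1.le)) 0
      Set.self_mem_Ici).mono Set.Ioi_subset_Ici_self
  have hlim : Filter.Tendsto g (nhdsWithin 0 (Set.Ioi 0)) (nhds 0) :=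
    tendsto_const_nhds.congr' (by
      filter_upwards [self_mem_nhdsWithin] with y hy using (heq hy).symm)
  have hg0 := tendsto_nhds_unique hc hlim
  have hm := mittagLeffler_pos h1 one_pos le_rfl
  simp [hg, mlKernel, hμ0.ne', (sub_pos.2 h1).ne'] at hg0
  exact hm.ne' hg0

theorem mlKernel_one_mul_exp_neg_strictAntiOn {μ : ℝ} (h1 : 1 < μ) (h2 : μ ≤ 2) :
    StrictAntiOn (fun x => mlKernel μ 1 x * Real.exp (-x)) (Set.Ici 0) := by
  refine strictAntiOn_of_deriv_neg (convex_Ici 0)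
    ((mlKernel_continuousOn h1 le_rfl).mul (by fun_prop)) fun x hx => ?_
  rw [interior_Ici] at hx
  have h := (mlKernel_one_hasDerivAt h1 hx).mul (hasDerivAt_neg x).exp
  have hd := h.deriv
  have he := Real.exp_pos (-x)
  have hlt := mlKernel_self_lt h1 h2 hx
  refine (hd.trans_lt ?_)
  nlinarith

theorem mlKernel_self_mul_exp_neg_monotoneOn {μ : ℝ} (h1 : 1 < μ) (h2 : μ ≤ 2) :
    MonotoneOn (fun x => mlKernel μ μ x * Real.exp (-x)) (Set.Ici 0) := by
  have h (x : ℝ) (hx : 0 < x) := (mlKernel_self_hasDerivAt h1 hx).mul (hasDerivAt_neg x).exp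
  refine monotoneOn_of_deriv_nonneg (convex_Ici 0)
    ((mlKernel_continuousOn h1 h1.le).mul (by fun_prop)) ?_ ?_ <;> rw [interior_Ici]
  · exact fun x hx => (h x hx).differentiableAt.differentiableWithinAt
  · intro x hx
    have he := Real.exp_pos (-x)
    have hle := mlKernel_le_deriv h1 h2 hx
    refine le_of_le_of_eq ?_ (h x hx).deriv.symm
    nlinarith

/-- `G(t,τ) > 0` on `[0,1) × [0,1)`. -/
theorem greenG_pos (μ ω : ℝ) (hμ1 : 1 < μ) (hμ2 : μ ≤ 2) (hω : 0 < ω)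
    (t τ : ℝ) (ht : t ∈ Set.Ico (0 : ℝ) 1) (hτ : τ ∈ Set.Ico (0 : ℝ) 1) :
    0 < greenG μ ω t τ := by
  have hμ0 : 0 < μ := by linarith
  obtain ⟨ht0, ht1⟩ := ht
  obtain ⟨hτ0, hτ1⟩ := hτ
  set l : ℝ := ω ^ μ⁻¹ with hl
  have hl0 : 0 < l := by positivity
  have hscale (s : ℝ) (hs : 0 ≤ s) : (l * s) ^ μ = ω * s ^ μ := by
    rw [Real.mul_rpow hl0.le hs, hl, Real.rpow_inv_rpow hω.le hμ0.ne']
  have hE (s : ℝ) (hs : 0 ≤ s) : mittagLeffler μ 1 (ω * s ^ μ) = mlKernel μ 1 (l * s) := by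
    rw [mlKernel_one, hscale s hs]
  have hE1 : mittagLeffler μ 1 ω = mlKernel μ 1 l := by
    simpa using hE 1 zero_le_one
  set c : ℝ := l ^ (μ - 1) with hc
  have hc0 : 0 < c := by positivity
  have hK (s : ℝ) (hs : 0 ≤ s) :
      s ^ (μ - 1) * mittagLeffler μ μ (ω * s ^ μ) = mlKernel μ μ (l * s) / c := by
    rw [mlKernel, hscale s hs, Real.mul_rpow hl0.le hs, ← hc]
    field_simp
  have hEpos (s : ℝ) (hs : 0 ≤ s) : 0 < mlKernel μ 1 s := by
    rw [mlKernel_one]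
    exact mittagLeffler_pos hμ1 one_pos (by positivity)
  have hKpos : 0 < mlKernel μ μ (l * (1 - τ)) := by
    have hs : 0 < l * (1 - τ) := mul_pos hl0 (by linarith)
    exact mul_pos (Real.rpow_pos_of_pos hs _) (mittagLeffler_pos hμ1 hμ0 (by positivity))
  have hEt := hEpos (l * t) (by positivity)
  have hEl := hEpos l hl0.le
  rw [greenG, hE t ht0, hE1, hK (1 - τ) (by linarith)]
  split_ifs with hle
  · rw [hK (t - τ) (by linarith), sub_pos, div_mul_div_comm, div_lt_div_iff₀ hc0 (by positivity)]
    have hlt : mlKernel μ 1 l * Real.exp (-l) < mlKernel μ 1 (l * t) * Real.exp (-(l * t)) :=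
      mlKernel_one_mul_exp_neg_strictAntiOn hμ1 hμ2 (Set.mem_Ici.2 (by positivity))
        (Set.mem_Ici.2 hl0.le) (by nlinarith)
    have hmono : mlKernel μ μ (l * (t - τ)) * Real.exp (-(l * (t - τ))) ≤
        mlKernel μ μ (l * (1 - τ)) * Real.exp (-(l * (1 - τ))) :=
      mlKernel_self_mul_exp_neg_monotoneOn hμ1 hμ2
        (Set.mem_Ici.2 (mul_nonneg hl0.le (by linarith)))
        (Set.mem_Ici.2 (mul_nonneg hl0.le (by linarith)))
        (mul_le_mul_of_nonneg_left (by linarith) hl0.le)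
    have hprod := mul_lt_mul_of_nonneg_of_pos' hmono hlt (by positivity) (by positivity)
    have he : Real.exp (-(l * (1 - τ))) * Real.exp (-(l * t)) =
        Real.exp (-(l * (t - τ))) * Real.exp (-l) := by
      rw [← Real.exp_add, ← Real.exp_add]
      ring_nf
    have hepos : 0 < Real.exp (-(l * (t - τ))) * Real.exp (-l) := by positivity
    have hfin : mlKernel μ μ (l * (t - τ)) * mlKernel μ 1 l <
        mlKernel μ 1 (l * t) * mlKernel μ μ (l * (1 - τ)) := by
      refine lt_of_mul_lt_mul_right (lt_of_eq_of_lt ?_ (hprod.trans_eq ?_)) hepos.le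
      · ring
      · rw [← he]
        ring
    nlinarith
  · rw [sub_zero]
    positivity
end
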